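/- Every ternary cubic form of Waring rank five over ℂ admits an apolar star configuration X(4). Equivalently: for every homogeneous cubic F ∈ ℂ[x₀,x₁,x₂] of Waring rank 5, there exist four linear forms l₁, l₂, l₃, l₄ in the dual variables y₀, y₁, y₂ such that any three of them are linearly independent and D_{l_i}∘D_{l_j}∘D_{l_k}(F) = 0 for all 1 ≤ i < j < k ≤ 4. -/

import Mathlib

open MvPolynomial

/-- The first-order differential operator `a₀∂₀ + a₁∂₁ + a₂∂₂` associated to the linear form
in the dual variables with coefficient vector `a`. -/
noncomputable def D {n : ℕ} (a : Fin n → ℂ) (F : MvPolynomial (Fin n) ℂ) :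
    MvPolynomial (Fin n) ℂ :=
  ∑ i, a i • pderiv i F

/-- The linear form `a₀x₀ + ⋯ + aₙxₙ` with coefficient vector `a`. -/
noncomputable def lin {n : ℕ} (a : Fin n → ℂ) : MvPolynomial (Fin n) ℂ :=
  ∑ i, MvPolynomial.C (a i) * X i

/-- The complex vector space `ℂ³`. -/
abbrev C3 : Type := Fin 3 → ℂ

/-- Trilinear forms on `ℂ³`. -/
abbrev TriForm : Type := C3 →ₗ[ℂ] C3 →ₗ[ℂ] C3 →ₗ[ℂ] ℂ

/-- A trilinear form is symmetric when it is invariant under two generating transpositions. -/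
structure TriForm.IsSymm (T : TriForm) : Prop where
  swap12 : ∀ a b c, T a b c = T b a c
  swap23 : ∀ a b c, T a b c = T a c b

/-- Four vectors, any three of them linearly independent, on whose triples `T` vanishes. -/
def HasStar (T : TriForm) : Prop :=
  ∃ l : Fin 4 → Fin 3 → ℂ,
    (∀ i j k : Fin 4, i < j → j < k → LinearIndependent ℂ ![l i, l j, l k]) ∧
    (∀ i j k : Fin 4, i < j → j < k → T (l i) (l j) (l k) = 0)

theorem forall_triples_fin_four {P : Fin 4 → Fin 4 → Fin 4 → Prop}
    (h012 : P 0 1 2) (h013 : P 0 1 3) (h023 : P 0 2 3) (h123 : P 1 2 3) :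
    ∀ i j k : Fin 4, i < j → j < k → P i j k := by
  intro i j k hij hjk
  fin_cases i <;> fin_cases j <;> fin_cases k <;>
    first | assumption | (exfalso; revert hij hjk; decide)

/-- The linear combination of `u, v, w` with coefficients `a`. -/
def comb (u v w a : C3) : C3 := a 0 • u + a 1 • v + a 2 • w

theorem linearIndependent_comb {u v w : C3} (h : LinearIndependent ℂ ![u, v, w]) {a b c : C3}
    (hd : (Matrix.of ![a, b, c]).det ≠ 0) :
    LinearIndependent ℂ ![comb u v w a, comb u v w b, comb u v w c] := by
  have h1 : LinearIndependent ℂ ![a, b, c] := Matrix.linearIndependent_rows_of_det_ne_zero hd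
  have h2 := h1.map' (Fintype.linearCombination ℂ ![u, v, w])
    (LinearMap.ker_eq_bot.2 h.fintypeLinearCombination_injective)
  have e : ![comb u v w a, comb u v w b, comb u v w c] =
      Fintype.linearCombination ℂ ![u, v, w] ∘ ![a, b, c] := by
    funext i
    fin_cases i <;> simp [comb, Fintype.linearCombination_apply, Fin.sum_univ_three]
  rw [e]
  exact h2

theorem hasStar_of_comb {T : TriForm} {u v w : C3} (h : LinearIndependent ℂ ![u, v, w])
    (a b c d : C3)
    (d1 : (Matrix.of ![a, b, c]).det ≠ 0) (d2 : (Matrix.of ![a, b, d]).det ≠ 0)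
    (d3 : (Matrix.of ![a, c, d]).det ≠ 0) (d4 : (Matrix.of ![b, c, d]).det ≠ 0)
    (t1 : T (comb u v w a) (comb u v w b) (comb u v w c) = 0)
    (t2 : T (comb u v w a) (comb u v w b) (comb u v w d) = 0)
    (t3 : T (comb u v w a) (comb u v w c) (comb u v w d) = 0)
    (t4 : T (comb u v w b) (comb u v w c) (comb u v w d) = 0) : HasStar T := by
  refine ⟨fun i => comb u v w (![a, b, c, d] i), ?_, ?_⟩
  · exact forall_triples_fin_four (linearIndependent_comb h d1) (linearIndependent_comb h d2)
      (linearIndependent_comb h d3) (linearIndependent_comb h d4)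
  · exact forall_triples_fin_four t1 t2 t3 t4

/-- Two vectors whose product kills `T`, together with a sufficiently general third vector,
extend to a star configuration. -/
theorem hasStar_of_apolar_pair {T : TriForm} (hT : T.IsSymm) {u v w : C3}
    (h : LinearIndependent ℂ ![w, u, v]) (huv : T u v = 0)
    (h1 : T u u w ≠ 0) (h2 : T u w w ≠ 0) (h3 : T v v w ≠ 0) (h4 : T v w w ≠ 0) :
    HasStar T := by
  have e1 : ∀ x, T u v x = 0 := fun x => by rw [huv]; rfl
  have e2 : ∀ x, T v u x = 0 := fun x => by rw [hT.swap12, e1]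
  have e3 : ∀ x, T u x v = 0 := fun x => by rw [hT.swap23, e1]
  have e4 : ∀ x, T v x u = 0 := fun x => by rw [hT.swap23, e2]
  refine hasStar_of_comb h ![0, 1, 0] ![0, 0, 1] ![1, 0, 0]
    ![1, - T u w w / T u u w, - T v w w / T v v w] ?_ ?_ ?_ ?_ ?_ ?_ ?_ ?_
  · simp [Matrix.det_fin_three]
  · simp [Matrix.det_fin_three]
  · simp [Matrix.det_fin_three, h3, h4]
  · simp [Matrix.det_fin_three, h1, h2]
  · simp [comb, e1]
  · simp [comb, e1]
  · simp [comb, e3, hT.swap23 u w u]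
    field_simp
    ring
  · simp [comb, e4, hT.swap23 v w v]
    field_simp
    ring

set_option linter.unusedSimpArgs false in
/-- The case where the polar quadratic form along `l` has rank two. -/
theorem hasStar_of_isotropic {T : TriForm} (hT : T.IsSymm) {l p q : C3}
    (h : LinearIndependent ℂ ![l, p, q]) (hl : T l l = 0)
    (hp : T l p p = 0) (hq : T l q q = 0) (hpq : T l p q ≠ 0) : HasStar T := by
  have e1 : ∀ x, T l l x = 0 := fun x => by rw [hl]; rfl
  have e2 : ∀ x, T l x l = 0 := fun x => by rw [hT.swap23, e1]
  have e3 : ∀ x, T x l l = 0 := fun x => by rw [hT.swap12, e2]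
  have p1 : T p l p = 0 := by rw [hT.swap12, hp]
  have p2 : T p p l = 0 := by rw [hT.swap23, p1]
  have q1 : T q l q = 0 := by rw [hT.swap12, hq]
  have q2 : T q q l = 0 := by rw [hT.swap23, q1]
  have m1 : T p l q = T l p q := hT.swap12 _ _ _
  have m2 : T p q l = T l p q := by rw [hT.swap23, m1]
  have m3 : T l q p = T l p q := hT.swap23 _ _ _
  have m4 : T q l p = T l p q := by rw [hT.swap12, m3]
  have m5 : T q p l = T l p q := by rw [hT.swap12, m2]
  set s := - T p p q / (2 * T l p q) with hs
  set r := - T p q q / (2 * T l p q) with hr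
  have hs' : 2 * s * T l p q = - T p p q := by rw [hs]; field_simp
  have hr' : 2 * r * T l p q = - T p q q := by rw [hr]; field_simp
  refine hasStar_of_comb h ![s + 1, 1, 0] ![s - 1, 1, 0] ![r + 1, 0, 1] ![r - 1, 0, 1]
    ?_ ?_ ?_ ?_ ?_ ?_ ?_ ?_
  · simp [Matrix.det_fin_three]
  · simp [Matrix.det_fin_three]
  · simp [Matrix.det_fin_three]; ring_nf; norm_num
  · simp [Matrix.det_fin_three]; ring_nf; norm_num
  all_goals simp [comb, e1, e2, e3, hp, p1, p2, hq, q1, q2, m1, m2, m3, m4, m5]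
  · linear_combination hs'
  · linear_combination hs'
  · linear_combination hr'
  · linear_combination hr'

theorem exists_ne_zero_forall_mul_add_ne_zero (α β : ℂ) (h : ¬ (α = 0 ∧ β = 0)) :
    ∃ s : ℂ, s ≠ 0 ∧ α * s + β ≠ 0 ∧ -(α * s) + β ≠ 0 ∧ 2 * (α * s) + β ≠ 0 ∧
      -(2 * (α * s)) + β ≠ 0 := by
  obtain ⟨s, hs⟩ := Infinite.exists_notMem_finset
    ({0, -β / α, β / α, -β / (2 * α), β / (2 * α)} : Finset ℂ)
  simp only [Finset.mem_insert, Finset.mem_singleton, not_or] at hs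
  obtain ⟨h0, h1, h2, h3, h4⟩ := hs
  rcases eq_or_ne α 0 with rfl | hα
  · have hβ : β ≠ 0 := fun hβ => h ⟨rfl, hβ⟩
    exact ⟨s, h0, by simpa using hβ⟩
  · refine ⟨s, h0, fun e => h1 ?_, fun e => h2 ?_, fun e => h3 ?_, fun e => h4 ?_⟩ <;>
      field_simp <;> first | linear_combination e | linear_combination -e

/-- The case of a polar quadratic form of rank one: cuspidal cubics, and conics together with a
tangent line. -/
theorem hasStar_of_rank_one {T : TriForm} (hT : T.IsSymm) {l x y : C3}
    (h : LinearIndependent ℂ ![x, y, l]) (hl : T l l = 0)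
    (hx : T l x = 0) (hy : T l y y = 1) (hxx : ¬ (T x x x = 0 ∧ T x x y = 0)) :
    HasStar T := by
  have e1 : ∀ z, T l l z = 0 := fun z => by rw [hl]; rfl
  have e2 : ∀ z, T l z l = 0 := fun z => by rw [hT.swap23, e1]
  have e3 : ∀ z, T z l l = 0 := fun z => by rw [hT.swap12, e2]
  have x1 : ∀ z, T l x z = 0 := fun z => by rw [hx]; rfl
  have x2 : ∀ z, T l z x = 0 := fun z => by rw [hT.swap23, x1]
  have x3 : ∀ z, T z l x = 0 := fun z => by rw [hT.swap12, x2]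
  have x4 : ∀ z, T z x l = 0 := fun z => by rw [hT.swap23, x3]
  have x5 : ∀ z, T x z l = 0 := fun z => by rw [hT.swap12, x4]
  have x6 : ∀ z, T x l z = 0 := fun z => by rw [hT.swap23, x5]
  have y1 : T y l y = 1 := by rw [hT.swap12, hy]
  have y2 : T y y l = 1 := by rw [hT.swap23, y1]
  have b1 : T x y x = T x x y := hT.swap23 _ _ _
  have b2 : T y x x = T x x y := by rw [hT.swap12, b1]
  have g1 : T y x y = T x y y := hT.swap12 _ _ _
  have g2 : T y y x = T x y y := by rw [hT.swap23, g1]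
  obtain ⟨s, s0, s1, s2, s3, s4⟩ := exists_ne_zero_forall_mul_add_ne_zero _ _ hxx
  set α := T x x x
  set β := T x x y
  set γ := T x y y
  set δ := T y y y
  -- the third coordinate making all triple products vanish at `a • x + y`, where `a` ranges
  -- over `s, -s, 2s, -2s`
  let c : ℂ → ℂ := fun a => 5 * α * s ^ 2 * a - α * a ^ 3 - 5 / 3 * β * s ^ 2 + β * a ^ 2
    - γ * a - δ / 3
  refine hasStar_of_comb h ![s, 1, c s] ![-s, 1, c (-s)] ![2 * s, 1, c (2 * s)]
    ![-(2 * s), 1, c (-(2 * s))] ?_ ?_ ?_ ?_ ?_ ?_ ?_ ?_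
  · have : s ^ 3 * (-(2 * (α * s)) + β) ≠ 0 := mul_ne_zero (pow_ne_zero _ s0) s4
    intro hd
    apply this
    simp [Matrix.det_fin_three, c] at hd
    linear_combination hd / 6
  · have : s ^ 3 * (2 * (α * s) + β) ≠ 0 := mul_ne_zero (pow_ne_zero _ s0) s3
    intro hd
    apply this
    simp [Matrix.det_fin_three, c] at hd
    linear_combination hd / 6
  · have : s ^ 3 * (-(α * s) + β) ≠ 0 := mul_ne_zero (pow_ne_zero _ s0) s2
    intro hd
    apply this
    simp [Matrix.det_fin_three, c] at hd
    linear_combination -hd / 12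
  · have : s ^ 3 * (α * s + β) ≠ 0 := mul_ne_zero (pow_ne_zero _ s0) s1
    intro hd
    apply this
    simp [Matrix.det_fin_three, c] at hd
    linear_combination -hd / 12
  all_goals
    simp [comb, e1, e2, e3, x1, x2, x3, x4, x5, x6, hy, y1, y2, b1, b2, g1, g2]
    simp only [c]
    ring

theorem exists_extending_functional (u v : C3) (h : LinearIndependent ℂ ![u, v]) :
    ∃ φ : C3 →ₗ[ℂ] ℂ, φ ≠ 0 ∧ ∀ w, φ w ≠ 0 → LinearIndependent ℂ ![w, u, v] := by
  have hlt : Submodule.span ℂ (Set.range ![u, v]) < ⊤ := by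
    refine lt_top_iff_ne_top.2 fun e => ?_
    have h1 := finrank_span_eq_card h
    rw [e, finrank_top] at h1
    simp at h1
  obtain ⟨φ, h0, hφ⟩ := Submodule.exists_le_ker_of_lt_top _ hlt
  refine ⟨φ, h0, fun w hw => ?_⟩
  exact linearIndependent_finCons.2 ⟨h, fun hm => hw (hφ hm)⟩

theorem exists_extending_vector (u v : C3) (h : LinearIndependent ℂ ![u, v]) :
    ∃ w, LinearIndependent ℂ ![w, u, v] := by
  obtain ⟨φ, h0, hφ⟩ := exists_extending_functional u v h
  obtain ⟨w, hw⟩ : ∃ w, φ w ≠ 0 := by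
    by_contra! hc
    exact h0 (LinearMap.ext hc)
  exact ⟨w, hφ w hw⟩

theorem eq_zero_of_triple {M : Type*} [AddCommGroup M] [Module ℂ M] {u v w : C3}
    (h : LinearIndependent ℂ ![u, v, w]) (φ : C3 →ₗ[ℂ] M)
    (hu : φ u = 0) (hv : φ v = 0) (hw : φ w = 0) : φ = 0 := by
  refine LinearMap.ext_on (h.span_eq_top_of_card_eq_finrank' (by simp)) ?_
  rintro _ ⟨i, rfl⟩
  fin_cases i <;> simpa

/-- A nonzero symmetric bilinear form has an anisotropic vector. -/
theorem exists_apply_self_ne_zero (A : C3 →ₗ[ℂ] C3 →ₗ[ℂ] ℂ) (hs : ∀ x y, A x y = A y x)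
    (h : A ≠ 0) : ∃ w, A w w ≠ 0 := by
  by_contra! hc
  refine h (LinearMap.ext fun x => LinearMap.ext fun y => ?_)
  have h1 := hc (x + y)
  simp only [map_add, LinearMap.add_apply, hc, hs y x] at h1
  simp only [LinearMap.zero_apply]
  linear_combination h1 / 2

theorem exists_cube_ne_zero {T : TriForm} (hT : T.IsSymm) (h : T ≠ 0) : ∃ v, T v v v ≠ 0 := by
  by_contra! hc
  refine h (LinearMap.ext fun z => ?_)
  by_contra hz
  obtain ⟨x, hx⟩ := exists_apply_self_ne_zero (T z) (hT.swap23 z) hz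
  have h1 := hc (x + z)
  have h2 := hc (x - z)
  have s1 : T x x z = T z x x := by rw [hT.swap23, hT.swap12]
  have s2 : T x z x = T z x x := by rw [hT.swap12]
  have s3 : T z z x = T x z z := by rw [hT.swap23, hT.swap12]
  have s4 : T z x z = T x z z := by rw [hT.swap12]
  simp only [map_add, map_sub, LinearMap.add_apply, LinearMap.sub_apply, hc, s1, s2, s3, s4]
    at h1 h2
  exact hx (by linear_combination (h1 - h2) / 6)

theorem exists_parameter (a b c : ℂ) (ha : a ≠ 0) :
    ∃ t : ℂ, t ≠ 0 ∧ a + t * b ≠ 0 ∧ a + 2 * t * b + t ^ 2 * c ≠ 0 := by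
  let p : Polynomial ℂ := Polynomial.X * ((Polynomial.C a + Polynomial.X * Polynomial.C b) *
    (Polynomial.C a + 2 * Polynomial.X * Polynomial.C b + Polynomial.X ^ 2 * Polynomial.C c))
  have hp : p ≠ 0 := by
    refine mul_ne_zero Polynomial.X_ne_zero (mul_ne_zero ?_ ?_) <;>
    · intro h
      have := congrArg (Polynomial.eval 0) h
      simp at this
      exact ha this
  obtain ⟨t, ht⟩ : ∃ t, p.eval t ≠ 0 := by
    by_contra! hc
    exact hp (Polynomial.funext (by simpa using hc))
  refine ⟨t, ?_⟩
  simp only [p, Polynomial.eval_mul, Polynomial.eval_add, Polynomial.eval_X, Polynomial.eval_C,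
    Polynomial.eval_pow, Polynomial.eval_ofNat, mul_ne_zero_iff] at ht
  exact ht

/-- Cones: ternary cubics that depend on at most two variables. -/
theorem hasStar_of_cone {T : TriForm} (hT : T.IsSymm) {l : C3} (hl0 : l ≠ 0) (hl : T l = 0) :
    HasStar T := by
  have e1 : ∀ x y, T l x y = 0 := fun x y => by rw [hl]; rfl
  have e2 : ∀ x y, T x l y = 0 := fun x y => by rw [hT.swap12, e1]
  have e3 : ∀ x y, T x y l = 0 := fun x y => by rw [hT.swap23, e2]
  by_cases h0 : T = 0
  · subst h0
    have hB : LinearIndependent ℂ ![(![1, 0, 0] : C3), ![0, 1, 0], ![0, 0, 1]] :=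
      Matrix.linearIndependent_rows_of_det_ne_zero
        (A := Matrix.of ![(![1, 0, 0] : C3), ![0, 1, 0], ![0, 0, 1]])
        (by simp [Matrix.det_fin_three])
    refine hasStar_of_comb hB ![1, 0, 0] ![0, 1, 0] ![0, 0, 1] ![1, 1, 1]
      ?_ ?_ ?_ ?_ rfl rfl rfl rfl
      <;> simp [Matrix.det_fin_three]
  obtain ⟨v, hv⟩ := exists_cube_ne_zero hT h0
  have hlv : LinearIndependent ℂ ![l, v] := by
    refine (LinearIndependent.pair_iff' hl0).2 fun a ha => hv ?_
    rw [← ha]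
    simp [e1]
  obtain ⟨w, hw⟩ := exists_extending_vector l v hlv
  obtain ⟨t, t0, t1, t2⟩ := exists_parameter (T v v v) (T v v w) (T v w w) hv
  have s1 : T v w v = T v v w := hT.swap23 _ _ _
  set g := T v v v + t * T v v w
  set k := T v v v + 2 * t * T v v w + t ^ 2 * T v w w
  refine hasStar_of_comb hw ![0, 1, 0] ![0, 0, 1] ![t, 0, 1] ![-(g * t), 1, k - g]
    ?_ ?_ ?_ ?_ ?_ ?_ ?_ ?_
  · simpa [Matrix.det_fin_three] using t0
  · simpa [Matrix.det_fin_three] using ⟨t1, t0⟩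
  · have : t * k ≠ 0 := mul_ne_zero t0 t2
    intro hd
    apply this
    simp [Matrix.det_fin_three] at hd
    linear_combination -hd
  · simpa [Matrix.det_fin_three] using t0
  · simp [comb, e1]
  · simp [comb, e1]
  · simp [comb, e1]
  · simp [comb, e3, s1]
    simp only [g, k]
    ring

/-- The case where the square of a linear form is apolar to the cubic. -/
theorem hasStar_of_apolar_square {T : TriForm} (hT : T.IsSymm) {l : C3} (hl0 : l ≠ 0)
    (hl : T l l = 0) : HasStar T := by
  by_cases hc : T l = 0
  · exact hasStar_of_cone hT hl0 hc
  have e1 : ∀ z, T l l z = 0 := fun z => by rw [hl]; rfl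
  have e2 : ∀ z, T l z l = 0 := fun z => by rw [hT.swap23, e1]
  have e3 : ∀ z, T z l l = 0 := fun z => by rw [hT.swap12, e2]
  obtain ⟨w₀, hw₀⟩ := exists_apply_self_ne_zero (T l) (hT.swap23 l) hc
  obtain ⟨r, hr⟩ := IsAlgClosed.exists_eq_mul_self (T l w₀ w₀)
  have hr0 : r ≠ 0 := by
    rintro rfl
    exact hw₀ (by simpa using hr)
  obtain ⟨w, hw⟩ : ∃ w, T l w w = 1 := by
    refine ⟨r⁻¹ • w₀, ?_⟩
    simp [hr]
    field_simp
  have hlw : LinearIndependent ℂ ![l, w] := by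
    refine (LinearIndependent.pair_iff' hl0).2 fun a ha => ?_
    rw [← ha] at hw
    simp [e1] at hw
  obtain ⟨x₀, hx₀⟩ := exists_extending_vector l w hlw
  obtain ⟨x, hxw, hx⟩ : ∃ x, T l w x = 0 ∧ LinearIndependent ℂ ![x, w, l] := by
    refine ⟨x₀ - T l w x₀ • w, by simp [hw], ?_⟩
    have := linearIndependent_comb hx₀ (a := ![1, 0, - T l w x₀]) (b := ![0, 0, 1])
      (c := ![0, 1, 0]) (by simp [Matrix.det_fin_three])
    simpa [comb, sub_eq_add_neg] using this
  have hwx : T l x w = 0 := by rw [hT.swap23, hxw]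
  by_cases hα : T l x x = 0
  · have hTx : T l x = 0 := eq_zero_of_triple hx _ hα hwx (e2 x)
    by_cases hxx : T x x x = 0 ∧ T x x w = 0
    · have hne : x - T x w w • l ≠ 0 := by
        have := (linearIndependent_comb hx (a := ![1, 0, - T x w w]) (b := ![0, 1, 0])
          (c := ![0, 0, 1]) (by simp [Matrix.det_fin_three])).ne_zero 0
        simpa [comb, sub_eq_add_neg] using this
      refine hasStar_of_cone hT hne ?_
      have f1 : T x l = 0 := LinearMap.ext fun z => by
        rw [hT.swap12, hTx]
      refine eq_zero_of_triple hx _ ?_ ?_ ?_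
      · refine eq_zero_of_triple hx _ ?_ ?_ ?_
        · simp [hxx.1, hTx]
        · simp [hxx.2, hTx]
        · simp [hTx, hT.swap23 x x l, f1]
      · refine eq_zero_of_triple hx _ ?_ ?_ ?_
        · simp [hT.swap23 x w x, hxx.2, hxw]
        · simp [hw]
        · simp [hT.swap23 x w l, f1, e2]
      · simp [f1, hl]
    · exact hasStar_of_rank_one hT hx hl hTx hw hxx
  · obtain ⟨q, hq⟩ := IsAlgClosed.exists_eq_mul_self (- T l x x)
    have hq0 : q ≠ 0 := by
      rintro rfl
      exact hα (by simpa using hq)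
    have hq' : T l x x = - (q * q) := by rw [← hq, neg_neg]
    have hli := linearIndependent_comb hx (a := ![0, 0, 1]) (b := ![q⁻¹, 1, 0])
      (c := ![-q⁻¹, 1, 0]) (by
        simp [Matrix.det_fin_three]
        exact hq0)
    refine hasStar_of_isotropic hT (l := l) (p := q⁻¹ • x + w) (q := -q⁻¹ • x + w)
      (by simpa [comb] using hli) hl ?_ ?_ ?_
    · simp [hq', hxw, hwx, hw]
      field_simp
      ring
    · simp [hq', hxw, hwx, hw]
      field_simp
      ring
    · simp [hq', hxw, hwx, hw]
      field_simp
      norm_num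

/-- The Hessian of a ternary cubic has a zero. -/
theorem exists_apolar_pair (T : TriForm) : ∃ u v : C3, u ≠ 0 ∧ v ≠ 0 ∧ T u v = 0 := by
  have hLI : LinearIndependent ℂ ![(![1, 0, 0] : C3), ![0, 1, 0], ![0, 0, 1]] :=
    Matrix.linearIndependent_rows_of_det_ne_zero
      (A := Matrix.of ![(![1, 0, 0] : C3), ![0, 1, 0], ![0, 0, 1]])
      (by simp [Matrix.det_fin_three])
  set a : C3 := ![1, 0, 0] with ha
  set b : C3 := ![0, 1, 0] with hb
  have ha0 : a ≠ 0 := hLI.ne_zero 0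
  by_cases hinj : Function.Injective (T a)
  · let e := (T a).linearEquivOfInjective hinj Subspace.dual_finrank_eq.symm
    obtain ⟨μ, hμ⟩ := Module.End.exists_eigenvalue (e.symm.toLinearMap ∘ₗ T b)
    obtain ⟨v, hv⟩ := hμ.exists_hasEigenvector
    refine ⟨b - μ • a, v, ?_, hv.2, ?_⟩
    · intro h
      have := congrFun h 1
      simp [ha, hb] at this
    · have h1 : e.symm (T b v) = μ • v := hv.apply_eq_smul
      rw [LinearEquiv.symm_apply_eq] at h1
      have h2 : e (μ • v) = T a (μ • v) := rfl
      rw [h2] at h1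
      simp [h1]
  · rw [← LinearMap.ker_eq_bot, Submodule.eq_bot_iff] at hinj
    push Not at hinj
    obtain ⟨v, hv, hv0⟩ := hinj
    exact ⟨a, v, ha0, hv0, hv⟩

/-- Functions on `ℂ³` given by a polynomial. -/
def IsPolyFun (g : C3 → ℂ) : Prop := ∃ p : MvPolynomial (Fin 3) ℂ, ∀ w, eval w p = g w

theorem IsPolyFun.linear (φ : C3 →ₗ[ℂ] ℂ) : IsPolyFun φ := by
  refine ⟨∑ i, C (φ (Pi.single i 1)) * X i, fun w => ?_⟩
  rw [LinearMap.pi_apply_eq_sum_univ φ w]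
  simp only [map_sum, map_mul, eval_C, eval_X, smul_eq_mul]
  refine Finset.sum_congr rfl fun i _ => ?_
  rw [mul_comm]
  congr 2
  ext j
  simp [Pi.single_apply, eq_comm]

theorem IsPolyFun.add {g h : C3 → ℂ} (hg : IsPolyFun g) (hh : IsPolyFun h) :
    IsPolyFun fun w => g w + h w := by
  obtain ⟨p, hp⟩ := hg
  obtain ⟨q, hq⟩ := hh
  exact ⟨p + q, fun w => by simp [hp, hq]⟩

theorem IsPolyFun.mul {g h : C3 → ℂ} (hg : IsPolyFun g) (hh : IsPolyFun h) :
    IsPolyFun fun w => g w * h w := by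
  obtain ⟨p, hp⟩ := hg
  obtain ⟨q, hq⟩ := hh
  exact ⟨p * q, fun w => by simp [hp, hq]⟩

theorem IsPolyFun.quadratic (A : C3 →ₗ[ℂ] C3 →ₗ[ℂ] ℂ) : IsPolyFun fun w => A w w := by
  have h : ∀ i : Fin 3, IsPolyFun fun w => w i * A (Pi.single i 1) w := fun i =>
    (IsPolyFun.linear (LinearMap.proj i)).mul (IsPolyFun.linear _)
  convert ((h 0).add (h 1)).add (h 2) using 2 with w
  have hw : w = w 0 • Pi.single 0 1 + w 1 • Pi.single 1 1 + w 2 • Pi.single 2 1 := by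
    ext i
    fin_cases i <;> simp
  conv_lhs => enter [1]; rw [hw]
  simp

theorem IsPolyFun.exists_mul_ne_zero {g h : C3 → ℂ} (hg : IsPolyFun g) (hh : IsPolyFun h)
    (g0 : ∃ w, g w ≠ 0) (h0 : ∃ w, h w ≠ 0) : ∃ w, g w * h w ≠ 0 := by
  obtain ⟨p, hp⟩ := hg
  obtain ⟨q, hq⟩ := hh
  obtain ⟨x, hx⟩ := g0
  obtain ⟨y, hy⟩ := h0
  have hpq : p * q ≠ 0 := by
    refine mul_ne_zero ?_ ?_
    · rintro rfl
      exact hx (by simp [← hp])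
    · rintro rfl
      exact hy (by simp [← hq])
  by_contra! hc
  exact hpq (MvPolynomial.funext fun w => by simp [hp, hq, hc])

/-- Every symmetric trilinear form on `ℂ³` admits an apolar star configuration. -/
theorem hasStar_of_isSymm {T : TriForm} (hT : T.IsSymm) : HasStar T := by
  by_cases hsq : ∃ l : C3, l ≠ 0 ∧ T l l = 0
  · obtain ⟨l, hl0, hl⟩ := hsq
    exact hasStar_of_apolar_square hT hl0 hl
  push Not at hsq
  have hne : ∀ l : C3, l ≠ 0 → T l ≠ 0 := fun l hl0 h => hsq l hl0 (by rw [h]; rfl)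
  have hlin : ∀ l : C3, l ≠ 0 → ∃ w, T l l w ≠ 0 := fun l hl0 => by
    by_contra! hc
    exact hsq l hl0 (LinearMap.ext hc)
  obtain ⟨u, v, hu, hv, huv⟩ := exists_apolar_pair T
  have hLI : LinearIndependent ℂ ![u, v] := by
    refine (LinearIndependent.pair_iff' hu).2 fun a ha => ?_
    subst ha
    rw [map_smul, smul_eq_zero] at huv
    rcases huv with rfl | h
    · simp at hv
    · exact hsq u hu h
  obtain ⟨φ, hφ0, hφ⟩ := exists_extending_functional u v hLI
  have hφ1 : ∃ w, φ w ≠ 0 := by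
    by_contra! hc
    exact hφ0 (LinearMap.ext hc)
  have p1 := IsPolyFun.linear φ
  have p2 := p1.mul (IsPolyFun.linear (T u u))
  have p3 := p2.mul (IsPolyFun.linear (T v v))
  have p4 := p3.mul (IsPolyFun.quadratic (T u))
  have n2 := p1.exists_mul_ne_zero (IsPolyFun.linear (T u u)) hφ1 (hlin u hu)
  have n3 := p2.exists_mul_ne_zero (IsPolyFun.linear (T v v)) n2 (hlin v hv)
  have n4 := p3.exists_mul_ne_zero (IsPolyFun.quadratic (T u)) n3
    (exists_apply_self_ne_zero _ (hT.swap23 u) (hne u hu))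
  obtain ⟨w, hw⟩ := p4.exists_mul_ne_zero (IsPolyFun.quadratic (T v)) n4
    (exists_apply_self_ne_zero _ (hT.swap23 v) (hne v hv))
  simp only [mul_ne_zero_iff] at hw
  obtain ⟨⟨⟨⟨w1, w2⟩, w3⟩, w4⟩, w5⟩ := hw
  exact hasStar_of_apolar_pair hT (hφ w w1) huv w2 w4 w3 w5

/-- The pairing of linear forms with coefficient vector `L` against dual vectors. -/
noncomputable def pairing (L : C3) : C3 →ₗ[ℂ] ℂ := Fintype.linearCombination ℂ L

theorem D_sum {n : ℕ} {ι : Type*} (s : Finset ι) (a : Fin n → ℂ)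
    (G : ι → MvPolynomial (Fin n) ℂ) : D a (∑ m ∈ s, G m) = ∑ m ∈ s, D a (G m) := by
  simp only [D, map_sum, Finset.smul_sum]
  exact Finset.sum_comm

theorem pderiv_lin {n : ℕ} (L : Fin n → ℂ) (i : Fin n) : pderiv i (lin L) = C (L i) := by
  simp [lin, pderiv_X, Pi.single_apply]

theorem D_C_mul_lin_pow (a L : C3) (k : ℂ) (n : ℕ) :
    D a (C k * lin L ^ (n + 1)) = C (k * (n + 1) * pairing L a) * lin L ^ n := by
  simp only [D, pderiv_C_mul, pderiv_pow, pderiv_lin, pairing,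
    Fintype.linearCombination_apply, Fin.sum_univ_three, smul_eq_C_mul, smul_eq_mul]
  simp
  ring

theorem D_D_D_lin_pow_three (a b c L : C3) :
    D a (D b (D c (lin L ^ 3))) = C (6 * (pairing L a * pairing L b * pairing L c)) := by
  have h3 := D_C_mul_lin_pow c L 1 2
  have h2 := D_C_mul_lin_pow b L (1 * ((2 : ℕ) + 1) * pairing L c) 1
  have h1 := D_C_mul_lin_pow a L (1 * ((2 : ℕ) + 1) * pairing L c * ((1 : ℕ) + 1) * pairing L b) 0
  rw [C_1, one_mul] at h3
  rw [h3, h2, h1, pow_zero, mul_one]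
  congr 1
  push_cast
  ring

/-- The symmetric trilinear form polarizing `∑ m, lin (L m) ^ 3`. -/
noncomputable def polarForm {s : ℕ} (L : Fin s → C3) : TriForm :=
  ∑ m, (pairing (L m)).smulRight ((pairing (L m)).smulRight (pairing (L m)))

theorem polarForm_apply {s : ℕ} (L : Fin s → C3) (a b c : C3) :
    polarForm L a b c = ∑ m, pairing (L m) a * pairing (L m) b * pairing (L m) c := by
  simp [polarForm, LinearMap.sum_apply, mul_assoc]

theorem polarForm_isSymm {s : ℕ} (L : Fin s → C3) : (polarForm L).IsSymm where
  swap12 a b c := by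
    simp only [polarForm_apply]
    exact Finset.sum_congr rfl fun _ _ => by ring
  swap23 a b c := by
    simp only [polarForm_apply]
    exact Finset.sum_congr rfl fun _ _ => by ring

/-- Every ternary cubic of Waring rank five admits an apolar star configuration `X(4)`:
four linear forms in the dual variables, any three of them linearly independent, all of
whose triple products annihilate `F`. -/
theorem rank_five_ternary_cubic_has_apolar_star_configuration
    (F : MvPolynomial (Fin 3) ℂ) (hF : F.IsHomogeneous 3)
    (hrank5 : ∃ L : Fin 5 → Fin 3 → ℂ, F = ∑ i, lin (L i) ^ 3)
    (hnot4 : ∀ s : ℕ, s ≤ 4 → ∀ L : Fin s → Fin 3 → ℂ, F ≠ ∑ i, lin (L i) ^ 3) :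
    ∃ l : Fin 4 → Fin 3 → ℂ,
      (∀ i j k : Fin 4, i < j → j < k → LinearIndependent ℂ ![l i, l j, l k]) ∧
      (∀ i j k : Fin 4, i < j → j < k → D (l i) (D (l j) (D (l k) F)) = 0) := by
  obtain ⟨L, rfl⟩ := hrank5
  obtain ⟨l, hl, hT⟩ := hasStar_of_isSymm (polarForm_isSymm L)
  refine ⟨l, hl, fun i j k hij hjk => ?_⟩
  simp only [D_sum, D_D_D_lin_pow_three]
  rw [← map_sum, ← Finset.mul_sum, ← polarForm_apply, hT i j k hij hjk, mul_zero, C_0]
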